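/- Let P₀ denote the set of affine functions of t alone and P₁ the set of affine functions of (t,x). (i) For σ ∈ (0,1) and any continuous u on ℝ₀^{d+1}: [u]^t_{Λ¹} + [u]^*_σ ≤ C sup_{r>0} sup_{(t,x)∈ℝ₀^{d+1}} r^{−σ} inf_{p∈P₀} ‖u − p‖_{L∞(Q_r(t,x))}, with C depending only on d and σ. (ii) For σ ∈ (1,2) and any u on ℝ₀^{d+1} differentiable in x: [u]^t_{Λ¹} + [u]^*_σ + [Du]^t_{(σ−1)/σ} ≤ C sup_{r>0} sup_{(t,x)∈ℝ₀^{d+1}} r^{−σ} inf_{p∈P₁} ‖u − p‖_{L∞(Q_r(t,x))}, with C depending only on d and σ. (iii) For σ = 1 and any continuous u on ℝ^{d+1}: [u]_{Λ¹(ℝ^{d+1})} ≤ C sup_{r>0} sup_{(t,x)∈ℝ^{d+1}} r^{−1} inf_{p∈P₁} ‖u − p‖_{L∞(Q_r(t,x))}, with C depending only on d. -/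

import Mathlib

open MeasureTheory Set Metric ENNReal
open scoped Classical
noncomputable section

namespace Nonlocal

variable {d : ℕ}

/-- `d`-dimensional Euclidean space. -/
abbrev E (d : ℕ) : Type := EuclideanSpace ℝ (Fin d)

/-- The parabolic cylinder `Q_r(t,x) = (t - r^σ, t) × B_r(x)`. -/
def Q (σ r t : ℝ) (x : E d) : Set (ℝ × E d) := Ioo (t - r ^ σ) t ×ˢ ball x r

/-- `Q_r = Q_r(0,0)`. -/
def Q0 (d : ℕ) (σ r : ℝ) : Set (ℝ × E d) := Q σ r 0 (0 : E d)

/-- The lower half space `ℝ₀^{d+1} = (-∞,0) × ℝ^d`. -/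
def lowerHalf (d : ℕ) : Set (ℝ × E d) := Iio (0 : ℝ) ×ˢ (univ : Set (E d))

/-- The spatial differential `Du`. -/
def Du (u : ℝ × E d → ℝ) (z : ℝ × E d) : E d →L[ℝ] ℝ :=
  fderiv ℝ (fun x => u (z.1, x)) z.2

/-- The time derivative `∂_t u`. -/
def ut (u : ℝ × E d → ℝ) (z : ℝ × E d) : ℝ :=
  deriv (fun s => u (s, z.2)) z.1

/-- The increment `δu(t,x,y)`, whose form depends on the order `σ`. -/
def deltaU (σ : ℝ) (u : ℝ × E d → ℝ) (t : ℝ) (x y : E d) : ℝ :=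
  u (t, x + y) - u (t, x) -
    (if 1 < σ then Du u (t, x) y
      else if σ = 1 then (if ‖y‖ < 1 then Du u (t, x) y else 0) else 0)

/-- Ellipticity bounds `λ(2-σ)|y|^{-d-σ} ≤ K(y) ≤ Λ(2-σ)|y|^{-d-σ}`. -/
def kernelBounds (σ lam Lam : ℝ) (K : E d → ℝ) : Prop :=
  ∀ y : E d, y ≠ 0 →
    lam * (2 - σ) * ‖y‖ ^ (-((d : ℝ) + σ)) ≤ K y ∧
      K y ≤ Lam * (2 - σ) * ‖y‖ ^ (-((d : ℝ) + σ))

/-- Cancellation condition `∫_{∂B_r} y K(y) dS(y) = 0` for all `r > 0`,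
formulated equivalently via vanishing of the integrals over all annuli. -/
def cancels (K : E d → ℝ) : Prop :=
  ∀ r₁ r₂ : ℝ, 0 < r₁ → r₁ < r₂ →
    (∫ y in {y : E d | r₁ ≤ ‖y‖ ∧ ‖y‖ ≤ r₂}, K y • y) = 0

/-- Membership in the class `L₀`. -/
def memL0 (σ lam Lam : ℝ) (K : E d → ℝ) : Prop :=
  kernelBounds σ lam Lam K ∧ (σ = 1 → cancels K)

/-- The nonlocal operator `L u(t,x) = ∫ δu(t,x,y) K(y) dy` (translation invariant kernel). -/
def Lop (σ : ℝ) (K : E d → ℝ) (u : ℝ × E d → ℝ) (z : ℝ × E d) : ℝ :=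
  ∫ y, deltaU σ u z.1 z.2 y * K y

/-- The nonlocal operator with `(t,x)`-dependent kernel. -/
def LopTX (σ : ℝ) (K : ℝ × E d → E d → ℝ) (u : ℝ × E d → ℝ) (z : ℝ × E d) : ℝ :=
  ∫ y, deltaU σ u z.1 z.2 y * K z y

/-- The maximal Pucci extremal operator `M⁺`. -/
def Mplus (σ lam Lam : ℝ) (u : ℝ × E d → ℝ) (z : ℝ × E d) : ℝ :=
  if σ = 1 then sSup {v | ∃ K : E d → ℝ, memL0 1 lam Lam K ∧ v = Lop 1 K u z}
  else ∫ y, (Lam * max (deltaU σ u z.1 z.2 y) 0 - lam * max (-deltaU σ u z.1 z.2 y) 0) *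
      ((2 - σ) * ‖y‖ ^ (-((d : ℝ) + σ)))

/-- The minimal Pucci extremal operator `M⁻`. -/
def Mminus (σ lam Lam : ℝ) (u : ℝ × E d → ℝ) (z : ℝ × E d) : ℝ :=
  if σ = 1 then sInf {v | ∃ K : E d → ℝ, memL0 1 lam Lam K ∧ v = Lop 1 K u z}
  else ∫ y, (lam * max (deltaU σ u z.1 z.2 y) 0 - Lam * max (-deltaU σ u z.1 z.2 y) 0) *
      ((2 - σ) * ‖y‖ ^ (-((d : ℝ) + σ)))

variable {F : Type*} [NormedAddCommGroup F]

/-- The parabolic Hölder seminorm `[f]_{β,α;Ω}` (exponent `β` in time and `α` in space). -/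
def holderE (β α : ℝ) (Ω : Set (ℝ × E d)) (f : ℝ × E d → F) : ℝ≥0∞ :=
  ⨆ (p : Ω) (q : Ω), ENNReal.ofReal
    (‖f p.1 - f q.1‖ / max (‖p.1.2 - q.1.2‖ ^ α) (|p.1.1 - q.1.1| ^ β))

/-- The sup norm `‖f‖_{L∞(Ω)}`. -/
def supENorm (Ω : Set (ℝ × E d)) (f : ℝ × E d → F) : ℝ≥0∞ :=
  ⨆ p : Ω, ENNReal.ofReal ‖f p.1‖

/-- The full Hölder norm `‖f‖_{β,α;Ω}`. -/
def pnormE (β α : ℝ) (Ω : Set (ℝ × E d)) (f : ℝ × E d → ℝ) : ℝ≥0∞ :=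
  supENorm Ω f + holderE β α Ω f

/-- The seminorm `[u]_{1+α/σ, σ+α; Ω} = [D^ν u]_{α/σ, σ+α-ν; Ω} + [∂_t u]_{α/σ, σ+α-ν; Ω}`
with `ν = ⌊σ+α⌋`. -/
def parab2Semi (σ α : ℝ) (Ω : Set (ℝ × E d)) (u : ℝ × E d → ℝ) : ℝ≥0∞ :=
  holderE (α / σ) (σ + α - (⌊σ + α⌋₊ : ℝ)) Ω
      (fun z => iteratedFDeriv ℝ ⌊σ + α⌋₊ (fun x => u (z.1, x)) z.2)
    + holderE (α / σ) (σ + α - (⌊σ + α⌋₊ : ℝ)) Ω (fun z => ut u z)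

/-- General parabolic seminorm `[u]_{β/σ, β; Ω}` of order `β ≥ 0` (sup norm for `β = 0`);
a time-derivative term appears when `β > σ`. -/
def pSemiGen (σ β : ℝ) (Ω : Set (ℝ × E d)) (u : ℝ × E d → ℝ) : ℝ≥0∞ :=
  if β = 0 then supENorm Ω u
  else
    holderE (if σ < β then (β - σ) / σ else β / σ) (β - ((⌈β⌉₊ : ℝ) - 1)) Ω
        (fun z => iteratedFDeriv ℝ (⌈β⌉₊ - 1) (fun x => u (z.1, x)) z.2)
      + (if σ < β then
          holderE ((β - σ) / σ) (β - ((⌈β⌉₊ : ℝ) - 1)) Ω (fun z => ut u z) else 0)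

/-- Hölder seminorm in `x` only: `[f]^*_{β;Ω}`. -/
def holderX (β : ℝ) (Ω : Set (ℝ × E d)) (f : ℝ × E d → F) : ℝ≥0∞ :=
  ⨆ (t : ℝ) (x : E d) (y : E d) (_ : (t, x) ∈ Ω) (_ : (t, y) ∈ Ω),
    ENNReal.ofReal (‖f (t, x) - f (t, y)‖ / ‖x - y‖ ^ β)

/-- Hölder seminorm in `t` only: `[f]^t_{β;Ω}`. -/
def holderT (β : ℝ) (Ω : Set (ℝ × E d)) (f : ℝ × E d → F) : ℝ≥0∞ :=
  ⨆ (t : ℝ) (s : ℝ) (x : E d) (_ : (t, x) ∈ Ω) (_ : (s, x) ∈ Ω),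
    ENNReal.ofReal (‖f (t, x) - f (s, x)‖ / |t - s| ^ β)

/-- Zygmund seminorm in `t` only: `[u]^t_{Λ¹(Ω)}`. -/
def zygT (Ω : Set (ℝ × E d)) (u : ℝ × E d → ℝ) : ℝ≥0∞ :=
  ⨆ (t : ℝ) (x : E d) (h : ℝ) (_ : 0 < h) (_ : (t, x) ∈ Ω) (_ : (t + h, x) ∈ Ω)
    (_ : (t - h, x) ∈ Ω),
    ENNReal.ofReal (|u (t + h, x) + u (t - h, x) - 2 * u (t, x)| / h)

/-- Zygmund seminorm in `(t,x)`: `[u]_{Λ¹(Ω)}`. -/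
def zygFull (Ω : Set (ℝ × E d)) (u : ℝ × E d → ℝ) : ℝ≥0∞ :=
  ⨆ (z : ℝ × E d) (h : ℝ × E d) (_ : h ≠ 0) (_ : z ∈ Ω) (_ : z + h ∈ Ω) (_ : z - h ∈ Ω),
    ENNReal.ofReal (|u (z + h) + u (z - h) - 2 * u z| / ‖h‖)

/-- The function `P(t,x)` of Lemma 3.3. -/
def Pfun (σ : ℝ) (u : ℝ × E d → ℝ) (z : ℝ × E d) : ℝ :=
  ∫ y, max (deltaU σ u z.1 z.2 y - deltaU σ u 0 (0 : E d) y) 0 *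
    ((2 - σ) * ‖y‖ ^ (-((d : ℝ) + σ)))

/-- The function `N(t,x)` of Lemma 3.3. -/
def Nfun (σ : ℝ) (u : ℝ × E d → ℝ) (z : ℝ × E d) : ℝ :=
  ∫ y, max (-(deltaU σ u z.1 z.2 y - deltaU σ u 0 (0 : E d) y)) 0 *
    ((2 - σ) * ‖y‖ ^ (-((d : ℝ) + σ)))

/-- Mollification of `u` in the time variable: `u^{(R)}`. -/
def tmoll (σ R : ℝ) (η : ℝ → ℝ) (u : ℝ × E d → ℝ) : ℝ × E d → ℝ :=
  fun z => ∫ s : ℝ, (2 * u (z.1 - R ^ σ * s, z.2) - u (z.1 - 2 * R ^ σ * s, z.2)) * η (s - 1)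

/-- First-order Taylor expansion of `u^{(R)}` at the origin. -/
def tmollTaylor (σ R : ℝ) (η : ℝ → ℝ) (u : ℝ × E d → ℝ) : ℝ × E d → ℝ :=
  fun z => tmoll σ R η u (0, 0)
    + z.1 * derivWithin (fun s => tmoll σ R η u (s, (0 : E d))) (Iio (0 : ℝ)) 0
    + fderiv ℝ (fun x => tmoll σ R η u ((0 : ℝ), x)) 0 z.2

/-- Mollification of `u` in space-time (case `σ = 1`). -/
def stmoll (R : ℝ) (η : ℝ → ℝ) (ζ : E d → ℝ) (u : ℝ × E d → ℝ) : ℝ × E d → ℝ :=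
  fun z => ∫ w : ℝ × E d,
    (2 * u (z.1 - R * w.1, z.2 - R • w.2) - u (z.1 - 2 * R * w.1, z.2 - R • w.2)) *
      (η (w.1 - 1) * ζ w.2)

/-- First-order Taylor expansion of the space-time mollification at the origin. -/
def stmollTaylor (R : ℝ) (η : ℝ → ℝ) (ζ : E d → ℝ) (u : ℝ × E d → ℝ) : ℝ × E d → ℝ :=
  fun z => stmoll R η ζ u (0, 0)
    + z.1 * derivWithin (fun s => stmoll R η ζ u (s, (0 : E d))) (Iio (0 : ℝ)) 0
    + fderiv ℝ (fun x => stmoll R η ζ u ((0 : ℝ), x)) 0 z.2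

end Nonlocal
open MeasureTheory Set Metric ENNReal Nonlocal

namespace Nonlocal

variable {d : ℕ}

theorem le_ofReal_mul_of_forall_lt {L S : ℝ≥0∞} {C : ℝ} (hC : 0 < C)
    (h : ∀ K : ℝ, 0 < K → S < ENNReal.ofReal K → L ≤ ENNReal.ofReal (C * K)) :
    L ≤ ENNReal.ofReal C * S := by
  rcases eq_or_ne S ⊤ with rfl | hS
  · rw [ENNReal.mul_top (by simpa using hC)]
    exact le_top
  refine ENNReal.le_of_forall_pos_le_add fun ε hε _ => ?_
  have hε' : (0 : ℝ) < ε := hε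
  have hK : 0 < S.toReal + ε / C := by positivity
  have hlt : S < ENNReal.ofReal (S.toReal + ε / C) := by
    rw [← ENNReal.ofReal_toReal hS, ENNReal.ofReal_lt_ofReal_iff (by simpa using hK)]
    simp only [ENNReal.toReal_ofReal ENNReal.toReal_nonneg]
    linarith [div_pos hε' hC]
  refine (h _ hK hlt).trans (le_of_eq ?_)
  rw [mul_add, mul_div_cancel₀ _ hC.ne', ENNReal.ofReal_add (by positivity) hε'.le,
    ENNReal.ofReal_mul hC.le, ENNReal.ofReal_toReal hS, ENNReal.ofReal_coe_nnreal]

theorem norm_le_of_supENorm_lt {F : Type*} [NormedAddCommGroup F] {Ω : Set (ℝ × E d)}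
    {f : ℝ × E d → F} {K : ℝ} (hK : 0 ≤ K) (h : supENorm Ω f < ENNReal.ofReal K) :
    ∀ w ∈ Ω, ‖f w‖ ≤ K := fun w hw =>
  (ENNReal.ofReal_le_ofReal_iff hK).1
    ((le_iSup (fun p : Ω => ENNReal.ofReal ‖f p.1‖) ⟨w, hw⟩).trans h.le)

theorem lt_ofReal_mul_of_ofReal_mul_lt {c c' K : ℝ} (hc : 0 < c) (hcc : c * c' = 1)
    {S : ℝ≥0∞} (h : ENNReal.ofReal c * S < ENNReal.ofReal K) :
    S < ENNReal.ofReal (K * c') := by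
  have hc' : c' = c⁻¹ := eq_inv_of_mul_eq_one_right hcc
  rw [hc', ← div_eq_mul_inv, ENNReal.ofReal_div_of_pos hc]
  rw [ENNReal.lt_div_iff_mul_lt (by simp [hc]) (by simp), mul_comm]
  exact h

/-- In every cylinder `Q_r(t,x)` with `t < 0`, `u` is within `K r^σ` of an affine function. -/
def AffineApprox (σ K : ℝ) (u : ℝ × E d → ℝ) : Prop :=
  ∀ r : ℝ, 0 < r → ∀ t : ℝ, t < 0 → ∀ x : E d, ∃ (a b : ℝ) (l : E d →L[ℝ] ℝ),
    ∀ w ∈ Q σ r t x, |u w - (a + b * w.1 + l w.2)| ≤ K * r ^ σ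

theorem exists_gt_lt_zero {t δ : ℝ} (ht : t < 0) (hδ : 0 < δ) :
    ∃ t' : ℝ, t < t' ∧ t' < 0 ∧ t' < t + δ := by
  obtain ⟨t', h₁, h₂⟩ := exists_between (lt_min ht (lt_add_of_pos_right t hδ))
  exact ⟨t', h₁, h₂.trans_le (min_le_left _ _), h₂.trans_le (min_le_right _ _)⟩

theorem rpow_one_div_rpow {a σ : ℝ} (ha : 0 ≤ a) (hσ : σ ≠ 0) : (a ^ (1 / σ)) ^ σ = a := by
  rw [← Real.rpow_mul ha, one_div_mul_cancel hσ, Real.rpow_one]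

theorem zygT_le_of_affineApprox {σ K : ℝ} (hσ : 0 < σ) {u : ℝ × E d → ℝ}
    (hu : AffineApprox σ K u) : zygT (lowerHalf d) u ≤ ENNReal.ofReal (12 * K) := by
  refine iSup_le fun t => iSup_le fun x => iSup_le fun h => iSup_le fun hh => iSup_le fun _ =>
    iSup_le fun ht => iSup_le fun _ => ?_
  have hth : t + h < 0 := ht.1
  obtain ⟨t', h₁, h₂, h₃⟩ := exists_gt_lt_zero hth hh
  set r : ℝ := (3 * h) ^ (1 / σ) with hr
  have hr0 : 0 < r := Real.rpow_pos_of_pos (by positivity) _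
  have hrσ : r ^ σ = 3 * h := rpow_one_div_rpow (by positivity) hσ.ne'
  obtain ⟨a, b, l, H⟩ := hu r hr0 t' h₂ x
  have mem : ∀ s : ℝ, t' - 3 * h < s → s < t' → (s, x) ∈ Q σ r t' x := fun s hs hs' =>
    ⟨⟨by rw [hrσ]; exact hs, hs'⟩, mem_ball_self hr0⟩
  have e₁ := abs_le.1 (H _ (mem (t + h) (by linarith) (by linarith)))
  have e₂ := abs_le.1 (H _ (mem (t - h) (by linarith) (by linarith)))
  have e₃ := abs_le.1 (H _ (mem t (by linarith) (by linarith)))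
  simp only [hrσ] at e₁ e₂ e₃
  refine ENNReal.ofReal_le_ofReal ((div_le_iff₀ hh).2 (abs_le.2 ⟨?_, ?_⟩)) <;>
    linarith [e₁.1, e₁.2, e₂.1, e₂.2, e₃.1, e₃.2]

theorem norm_le_of_second_difference_le {f : E d → ℝ} {x : E d} {σ A B R : ℝ} (hσ : 1 < σ)
    (hR : 0 < R) (hA : 0 ≤ A) (hB : 0 ≤ B) (hf : DifferentiableAt ℝ f x)
    (hbd : ∀ y ∈ ball x R, |f y| ≤ A * R ^ σ)
    (hdiff : ∀ w : E d, |f (x + (2 : ℝ) • w) + f x - 2 * f (x + w)| ≤ B * ‖w‖ ^ σ) :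
    ‖fderiv ℝ f x‖ ≤ (4 * A + B / (1 - (1 / 2) ^ (σ - 1))) * R ^ (σ - 1) := by
  set q : ℝ := (1 / 2) ^ (σ - 1) with hq
  have hq0 : 0 < q := by positivity
  have hq1 : q < 1 := Real.rpow_lt_one (by norm_num) (by norm_num) (by linarith)
  have hR1 : R ^ σ = R * R ^ (σ - 1) := by
    rw [Real.rpow_sub_one hR.ne', mul_div_cancel₀ _ hR.ne']
  have hRp : 0 < R ^ (σ - 1) := Real.rpow_pos_of_pos hR _
  refine ContinuousLinearMap.opNorm_le_of_unit_norm
    (by have : 0 < 1 - q := by linarith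
        positivity) fun v hv => ?_
  let s : ℕ → ℝ := fun n => R / 2 * (1 / 2) ^ n
  have hs0 : ∀ n, 0 < s n := fun n => by positivity
  have hs1 : ∀ n, s n = 2 * s (n + 1) := fun n => by simp only [s, pow_succ]; ring
  have hsp : ∀ n, s n ^ (σ - 1) ≤ R ^ (σ - 1) * q ^ n := fun n => by
    have h₁ : s n ≤ R * (1 / 2) ^ n := by
      have : 0 < (1 / 2 : ℝ) ^ n := by positivity
      simp only [s]; nlinarith
    calc s n ^ (σ - 1) ≤ (R * (1 / 2) ^ n) ^ (σ - 1) :=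
          Real.rpow_le_rpow (hs0 n).le h₁ (by linarith)
      _ = R ^ (σ - 1) * q ^ n := by
          rw [Real.mul_rpow hR.le (by positivity), hq, ← Real.rpow_natCast, ← Real.rpow_natCast,
            ← Real.rpow_mul (by norm_num), ← Real.rpow_mul (by norm_num), mul_comm (n : ℝ)]
  let a : ℕ → ℝ := fun n => (s n)⁻¹ * (f (x + s n • v) - f x)
  have hstep : ∀ n, dist (a n) (a (n + 1)) ≤ B * R ^ (σ - 1) * q ^ n := fun n => by
    have hp := hs0 (n + 1)
    have hd := hdiff (s (n + 1) • v)
    rw [smul_smul, ← hs1, norm_smul, hv, mul_one, Real.norm_of_nonneg hp.le] at hd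
    have hpow : s (n + 1) ^ σ = s (n + 1) * s (n + 1) ^ (σ - 1) := by
      rw [Real.rpow_sub_one hp.ne', mul_div_cancel₀ _ hp.ne']
    have heq : a n - a (n + 1)
        = (2 * s (n + 1))⁻¹ * (f (x + s n • v) + f x - 2 * f (x + s (n + 1) • v)) := by
      simp only [a]
      rw [hs1 n]
      field_simp
      ring
    rw [Real.dist_eq, heq, abs_mul, abs_of_pos (by positivity)]
    calc (2 * s (n + 1))⁻¹ * |f (x + s n • v) + f x - 2 * f (x + s (n + 1) • v)|
        ≤ (2 * s (n + 1))⁻¹ * (B * (s (n + 1) * s (n + 1) ^ (σ - 1))) := by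
          rw [← hpow]; gcongr
      _ = B * (s (n + 1) ^ (σ - 1)) / 2 := by field_simp
      _ ≤ B * (s n ^ (σ - 1)) := by
          have h₁ : s (n + 1) ^ (σ - 1) ≤ s n ^ (σ - 1) :=
            Real.rpow_le_rpow hp.le (by rw [hs1 n]; linarith) (by linarith)
          have h₂ := mul_le_mul_of_nonneg_left h₁ hB
          have h₃ : 0 ≤ B * s (n + 1) ^ (σ - 1) := by positivity
          linarith
      _ ≤ B * R ^ (σ - 1) * q ^ n := by
          rw [mul_assoc]; exact mul_le_mul_of_nonneg_left (hsp n) hB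
  have hs_tendsto : Filter.Tendsto s Filter.atTop (nhdsWithin 0 {0}ᶜ) := by
    refine tendsto_nhdsWithin_iff.2 ⟨?_, Filter.Eventually.of_forall fun n => (hs0 n).ne'⟩
    simpa [s] using (tendsto_pow_atTop_nhds_zero_of_lt_one (r := (1 / 2 : ℝ)) (by norm_num)
      (by norm_num)).const_mul (R / 2)
  have hlim : Filter.Tendsto a Filter.atTop (nhds (fderiv ℝ f x v)) := by
    have := (hf.hasFDerivAt.hasLineDerivAt v).tendsto_slope_zero
    exact this.comp hs_tendsto
  have h0 := dist_le_of_le_geometric_of_tendsto₀ q _ hq1 hstep hlim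
  have hs00 : s 0 = R / 2 := by simp [s]
  have hx := hbd x (mem_ball_self hR)
  have hy := hbd (x + s 0 • v) (by
    rw [mem_ball, dist_self_add_left, norm_smul, hv, mul_one, Real.norm_of_nonneg (hs0 0).le, hs00]
    linarith)
  have ha0 : |a 0| ≤ 4 * A * R ^ (σ - 1) := by
    simp only [a]
    rw [abs_mul, abs_of_pos (inv_pos.2 (hs0 0))]
    calc (s 0)⁻¹ * |f (x + s 0 • v) - f x| ≤ (s 0)⁻¹ * (2 * A * (R * R ^ (σ - 1))) := by
          refine mul_le_mul_of_nonneg_left ?_ (inv_pos.2 (hs0 0)).le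
          rw [← hR1]
          exact (abs_sub _ _).trans (by linarith)
      _ = 4 * A * R ^ (σ - 1) := by rw [hs00]; field_simp; ring
  rw [Real.dist_eq] at h0
  rw [Real.norm_eq_abs]
  have h1 := abs_sub_abs_le_abs_sub (fderiv ℝ f x v) (a 0)
  rw [abs_sub_comm] at h1
  have h2 : (4 * A + B / (1 - q)) * R ^ (σ - 1)
      = 4 * A * R ^ (σ - 1) + B * R ^ (σ - 1) / (1 - q) := by ring
  rw [h2]
  linarith

/-- The constant in the estimate of `Du` by the slope of an approximating affine function. -/
def slopeConst (σ : ℝ) : ℝ := 16 + 4 * 3 ^ σ / (1 - (1 / 2) ^ (σ - 1))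

theorem slopeConst_pos {σ : ℝ} (hσ : 1 < σ) : 0 < slopeConst σ := by
  have : (1 / 2 : ℝ) ^ (σ - 1) < 1 :=
    Real.rpow_lt_one (by norm_num) (by norm_num) (by linarith)
  have : 0 < 1 - (1 / 2 : ℝ) ^ (σ - 1) := by linarith
  unfold slopeConst
  positivity

theorem AffineApprox.abs_second_difference_le {σ K : ℝ} (hσ : 0 < σ)
    {u : ℝ × E d → ℝ} (hu : AffineApprox σ K u) {t : ℝ} (ht : t < 0) (x w : E d) :
    |u (t, x + (2 : ℝ) • w) + u (t, x) - 2 * u (t, x + w)| ≤ 4 * 3 ^ σ * K * ‖w‖ ^ σ := by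
  rcases eq_or_ne w 0 with rfl | hw
  · simp [Real.zero_rpow hσ.ne', ← two_mul]
  have hw0 : 0 < ‖w‖ := norm_pos_iff.2 hw
  have hr0 : 0 < 3 * ‖w‖ := by positivity
  obtain ⟨t', h₁, h₂, h₃⟩ := exists_gt_lt_zero ht (Real.rpow_pos_of_pos hr0 σ)
  obtain ⟨a, b, l, H⟩ := hu _ hr0 t' h₂ x
  have mem : ∀ y : E d, ‖y‖ < 3 * ‖w‖ → (t, x + y) ∈ Q σ (3 * ‖w‖) t' x := fun y hy =>
    ⟨⟨by linarith, h₁⟩, by simpa [mem_ball] using hy⟩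
  have e₁ := abs_le.1 (H _ (mem ((2 : ℝ) • w) (by
    rw [norm_smul, Real.norm_of_nonneg two_pos.le]; linarith)))
  have e₂ := abs_le.1 (H _ (mem w (by linarith)))
  have e₃ := abs_le.1 (H _ (mem 0 (by simpa using hw)))
  simp only [map_add, map_smul, smul_eq_mul, add_zero] at e₁ e₂ e₃
  rw [Real.mul_rpow (by norm_num) hw0.le] at e₁ e₂ e₃
  refine abs_le.2 ⟨?_, ?_⟩ <;> linarith [e₁.1, e₁.2, e₂.1, e₂.2, e₃.1, e₃.2]

/-- The slope of an affine function close to `u(t,·)` on `B_R(x)` is close to `Du(t,x)`. -/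
theorem AffineApprox.norm_Du_sub_le {σ K : ℝ} (hσ : σ ∈ Ioo (1 : ℝ) 2) (hK : 0 ≤ K)
    {u : ℝ × E d → ℝ} (hu : AffineApprox σ K u) {t : ℝ} (ht : t < 0) {x : E d}
    (hd : DifferentiableAt ℝ (fun x => u (t, x)) x) {R : ℝ} (hR : 0 < R) {a : ℝ}
    {l : E d →L[ℝ] ℝ} (h : ∀ y ∈ ball x R, |u (t, y) - (a + l y)| ≤ 4 * K * R ^ σ) :
    ‖Du u (t, x) - l‖ ≤ slopeConst σ * K * R ^ (σ - 1) := by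
  have hl : HasFDerivAt (fun y => a + l y) l x := l.hasFDerivAt.const_add a
  have hg : HasFDerivAt (fun y => u (t, y) - (a + l y)) (Du u (t, x) - l) x :=
    hd.hasFDerivAt.sub hl
  have key := norm_le_of_second_difference_le (A := 4 * K) (B := 4 * 3 ^ σ * K) hσ.1 hR
    (by positivity) (by positivity) hg.differentiableAt h fun w => by
      refine le_trans (le_of_eq ?_) (hu.abs_second_difference_le (by linarith [hσ.1]) ht x w)
      simp only [map_add, map_smul, smul_eq_mul]
      congr 1
      ring
  rw [hg.fderiv] at key
  refine key.trans (le_of_eq ?_)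
  unfold slopeConst
  ring

theorem holderX_Du_le_of_affineApprox {σ K : ℝ} (hσ : σ ∈ Ioo (1 : ℝ) 2) (hK : 0 ≤ K)
    {u : ℝ × E d → ℝ} (hu : AffineApprox σ K u)
    (hd : ∀ z ∈ lowerHalf d, DifferentiableAt ℝ (fun x => u (z.1, x)) z.2) :
    holderX (σ - 1) (lowerHalf d) (Du u) ≤ ENNReal.ofReal (2 * slopeConst σ * K) := by
  refine iSup_le fun t => iSup_le fun x => iSup_le fun y => iSup_le fun htx =>
    iSup_le fun hty => ENNReal.ofReal_le_ofReal ?_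
  have hC := slopeConst_pos hσ.1
  rcases eq_or_ne x y with rfl | hxy
  · simpa using by positivity
  have ht : t < 0 := htx.1
  have hρ : 0 < ‖x - y‖ := norm_pos_iff.2 (sub_ne_zero.2 hxy)
  set ρ := ‖x - y‖ with hρdef
  have hr0 : 0 < 2 * ρ := by positivity
  obtain ⟨t', h₁, h₂, h₃⟩ := exists_gt_lt_zero ht (Real.rpow_pos_of_pos hr0 σ)
  obtain ⟨a, b, l, H⟩ := hu _ hr0 t' h₂ x
  have h4 : (2 * ρ) ^ σ ≤ 4 * ρ ^ σ := by
    rw [Real.mul_rpow (by norm_num) hρ.le]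
    gcongr
    calc (2 : ℝ) ^ σ ≤ 2 ^ (2 : ℝ) := Real.rpow_le_rpow_of_exponent_le (by norm_num) hσ.2.le
      _ = 4 := by norm_num
  have bd : ∀ z ∈ ball x (2 * ρ), |u (t, z) - (a + b * t + l z)| ≤ 4 * K * ρ ^ σ := fun z hz =>
    (H (t, z) ⟨⟨by linarith, h₁⟩, hz⟩).trans (by nlinarith)
  have ex := hu.norm_Du_sub_le hσ hK ht (hd _ htx) hρ (a := a + b * t) (l := l)
    fun z hz => bd z (ball_subset_ball (by linarith) hz)
  have ey := hu.norm_Du_sub_le hσ hK ht (hd _ hty) hρ (a := a + b * t) (l := l)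
    fun z hz => bd z (ball_subset_ball' (by rw [dist_comm, dist_eq_norm]; linarith) hz)
  rw [div_le_iff₀ (Real.rpow_pos_of_pos hρ _)]
  have := norm_sub_le (Du u (t, x) - l) (Du u (t, y) - l)
  rw [sub_sub_sub_cancel_right] at this
  linarith

theorem AffineApprox.norm_Du_sub_le_of_lt {σ K : ℝ} (hσ : σ ∈ Ioo (1 : ℝ) 2) (hK : 0 ≤ K)
    {u : ℝ × E d → ℝ} (hu : AffineApprox σ K u)
    (hd : ∀ z ∈ lowerHalf d, DifferentiableAt ℝ (fun x => u (z.1, x)) z.2) {s t : ℝ}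
    (hst : s < t) (ht : t < 0) (x : E d) :
    ‖Du u (t, x) - Du u (s, x)‖ ≤ 4 * slopeConst σ * K * (t - s) ^ ((σ - 1) / σ) := by
  have hC := slopeConst_pos hσ.1
  have hσ0 : 0 < σ := by linarith [hσ.1]
  have hδ : 0 < t - s := by linarith
  obtain ⟨t', h₁, h₂, h₃⟩ := exists_gt_lt_zero ht hδ
  set r : ℝ := (2 * (t - s)) ^ (1 / σ) with hr
  have hr0 : 0 < r := Real.rpow_pos_of_pos (by positivity) _
  have hrσ : r ^ σ = 2 * (t - s) := rpow_one_div_rpow (by positivity) hσ0.ne'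
  obtain ⟨a, b, l, H⟩ := hu r hr0 t' h₂ x
  have bd : ∀ τ, s ≤ τ → τ ≤ t → ‖Du u (τ, x) - l‖ ≤ slopeConst σ * K * r ^ (σ - 1) :=
    fun τ hτ hτ' => by
      have hτ0 : τ < 0 := by linarith
      refine hu.norm_Du_sub_le hσ hK hτ0 (hd (τ, x) ⟨hτ0, mem_univ _⟩) hr0
        (a := a + b * τ) (l := l) fun z hz => ?_
      refine (H (τ, z) ⟨⟨by rw [hrσ]; linarith, by linarith⟩, hz⟩).trans ?_
      have : 0 ≤ K * r ^ σ := by positivity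
      linarith
  have hr2 : r ^ (σ - 1) ≤ 2 * (t - s) ^ ((σ - 1) / σ) := by
    rw [hr, ← Real.rpow_mul (by positivity), one_div_mul_eq_div,
      Real.mul_rpow (by norm_num) hδ.le]
    gcongr
    calc (2 : ℝ) ^ ((σ - 1) / σ) ≤ 2 ^ (1 : ℝ) :=
          Real.rpow_le_rpow_of_exponent_le (by norm_num) ((div_le_one hσ0).2 (by linarith))
      _ = 2 := Real.rpow_one 2
  have h := norm_sub_le (Du u (t, x) - l) (Du u (s, x) - l)
  rw [sub_sub_sub_cancel_right] at h
  have hCK : 0 ≤ slopeConst σ * K := by positivity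
  have := mul_le_mul_of_nonneg_left hr2 hCK
  linarith [bd t hst.le le_rfl, bd s le_rfl hst.le]

theorem holderT_Du_le_of_affineApprox {σ K : ℝ} (hσ : σ ∈ Ioo (1 : ℝ) 2) (hK : 0 ≤ K)
    {u : ℝ × E d → ℝ} (hu : AffineApprox σ K u)
    (hd : ∀ z ∈ lowerHalf d, DifferentiableAt ℝ (fun x => u (z.1, x)) z.2) :
    holderT ((σ - 1) / σ) (lowerHalf d) (Du u) ≤ ENNReal.ofReal (4 * slopeConst σ * K) := by
  refine iSup_le fun t => iSup_le fun s => iSup_le fun x => iSup_le fun ht =>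
    iSup_le fun hs => ENNReal.ofReal_le_ofReal ?_
  have hC := slopeConst_pos hσ.1
  rcases lt_trichotomy s t with hst | rfl | hst
  · rw [abs_of_pos (sub_pos.2 hst), div_le_iff₀ (Real.rpow_pos_of_pos (sub_pos.2 hst) _)]
    exact hu.norm_Du_sub_le_of_lt hσ hK hd hst ht.1 x
  · simpa using by positivity
  · rw [abs_sub_comm, abs_of_pos (sub_pos.2 hst), norm_sub_rev,
      div_le_iff₀ (Real.rpow_pos_of_pos (sub_pos.2 hst) _)]
    exact hu.norm_Du_sub_le_of_lt hσ hK hd hst hs.1 x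

theorem holderX_le_of_time_affine_approx {σ K : ℝ} (hσ : σ ∈ Ioo (0 : ℝ) 1) (hK : 0 ≤ K)
    {u : ℝ × E d → ℝ}
    (hu : ∀ r : ℝ, 0 < r → ∀ t : ℝ, t < 0 → ∀ x : E d, ∃ a b : ℝ,
      ∀ w ∈ Q σ r t x, |u w - (a + b * w.1)| ≤ K * r ^ σ) :
    holderX σ (lowerHalf d) u ≤ ENNReal.ofReal (4 * K) := by
  refine iSup_le fun t => iSup_le fun x => iSup_le fun y => iSup_le fun htx =>
    iSup_le fun _ => ENNReal.ofReal_le_ofReal ?_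
  rcases eq_or_ne x y with rfl | hxy
  · simpa using hK
  have ht : t < 0 := htx.1
  have hρ : 0 < ‖x - y‖ := norm_pos_iff.2 (sub_ne_zero.2 hxy)
  have hr0 : 0 < 2 * ‖x - y‖ := by positivity
  obtain ⟨t', h₁, h₂, h₃⟩ := exists_gt_lt_zero ht (Real.rpow_pos_of_pos hr0 σ)
  obtain ⟨a, b, H⟩ := hu _ hr0 t' h₂ x
  have ex := abs_le.1 (H (t, x) ⟨⟨by linarith, h₁⟩, mem_ball_self hr0⟩)
  have ey := abs_le.1 (H (t, y) ⟨⟨by linarith, h₁⟩, by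
    rw [mem_ball, dist_comm, dist_eq_norm]; linarith⟩)
  have h2 : (2 * ‖x - y‖) ^ σ ≤ 2 * ‖x - y‖ ^ σ := by
    rw [Real.mul_rpow (by norm_num) hρ.le]
    gcongr
    calc (2 : ℝ) ^ σ ≤ 2 ^ (1 : ℝ) := Real.rpow_le_rpow_of_exponent_le (by norm_num) hσ.2.le
      _ = 2 := Real.rpow_one 2
  have h3 := mul_le_mul_of_nonneg_left h2 hK
  rw [div_le_iff₀ (Real.rpow_pos_of_pos hρ _), Real.norm_eq_abs]
  refine abs_le.2 ⟨?_, ?_⟩ <;> linarith [ex.1, ex.2, ey.1, ey.2]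

theorem zygFull_le_of_affine_approx {K : ℝ} {u : ℝ × E d → ℝ}
    (hu : ∀ r : ℝ, 0 < r → ∀ (t : ℝ) (x : E d), ∃ (a b : ℝ) (l : E d →L[ℝ] ℝ),
      ∀ w ∈ Q 1 r t x, |u w - (a + b * w.1 + l w.2)| ≤ K * r) :
    zygFull (univ : Set (ℝ × E d)) u ≤ ENNReal.ofReal (12 * K) := by
  refine iSup_le fun z => iSup_le fun h => iSup_le fun hh => iSup_le fun _ => iSup_le fun _ =>
    iSup_le fun _ => ENNReal.ofReal_le_ofReal ?_
  have hn : 0 < ‖h‖ := norm_pos_iff.2 hh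
  obtain ⟨a, b, l, H⟩ := hu (3 * ‖h‖) (by positivity) (z.1 + 3 / 2 * ‖h‖) z.2
  have mem : ∀ k : ℝ × E d, ‖k‖ ≤ ‖h‖ → z + k ∈ Q 1 (3 * ‖h‖) (z.1 + 3 / 2 * ‖h‖) z.2 :=
    fun k hk => by
      have hk1 := abs_le.1 ((norm_fst_le k).trans hk)
      have hk2 := (norm_snd_le k).trans hk
      refine ⟨⟨?_, ?_⟩, ?_⟩
      · rw [Real.rpow_one, Prod.fst_add]; linarith [hk1.1]
      · rw [Prod.fst_add]; linarith [hk1.2]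
      · rw [mem_ball, Prod.snd_add, dist_self_add_left]; linarith
  have e₁ := abs_le.1 (H _ (mem h le_rfl))
  have e₂ := abs_le.1 (H _ (mem (-h) (norm_neg h).le))
  have e₃ := abs_le.1 (H _ (mem 0 (by simp)))
  simp only [← sub_eq_add_neg, add_zero, Prod.fst_add, Prod.snd_add, Prod.fst_sub, Prod.snd_sub,
    map_add, map_sub] at e₁ e₂ e₃
  rw [div_le_iff₀ hn]
  refine abs_le.2 ⟨?_, ?_⟩ <;> linarith [e₁.1, e₁.2, e₂.1, e₂.2, e₃.1, e₃.2]

end Nonlocal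

/-- Lemma 5.5: Campanato-type characterizations, bounding the Zygmund and
Hölder seminorms by the supremum over cylinders of the best-approximation quantities
`r^{-σ} inf_p ‖u - p‖_{L∞(Q_r(t,x))}` with `p` affine in `t` (case (i)) or in `(t,x)`
(cases (ii), (iii)). -/
theorem statement19 (d : ℕ) (hd : 1 ≤ d) :
    -- (i) σ ∈ (0,1)
    (∀ σ : ℝ, σ ∈ Ioo (0 : ℝ) 1 →
      ∃ C : ℝ, 0 < C ∧
        ∀ u : ℝ × E d → ℝ, ContinuousOn u (lowerHalf d) →
          zygT (lowerHalf d) u + holderX σ (lowerHalf d) u ≤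
            ENNReal.ofReal C *
              ⨆ (r : ℝ) (_ : 0 < r) (t : ℝ) (_ : t < 0) (x : E d),
                ENNReal.ofReal (r ^ (-σ)) *
                  ⨅ (a : ℝ) (b : ℝ), supENorm (Q σ r t x) (fun w => u w - (a + b * w.1))) ∧
    -- (ii) σ ∈ (1,2)
    (∀ σ : ℝ, σ ∈ Ioo (1 : ℝ) 2 →
      ∃ C : ℝ, 0 < C ∧
        ∀ u : ℝ × E d → ℝ,
          (∀ z ∈ lowerHalf d, DifferentiableAt ℝ (fun x => u (z.1, x)) z.2) →
          zygT (lowerHalf d) u + holderX (σ - 1) (lowerHalf d) (Du u)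
              + holderT ((σ - 1) / σ) (lowerHalf d) (Du u) ≤
            ENNReal.ofReal C *
              ⨆ (r : ℝ) (_ : 0 < r) (t : ℝ) (_ : t < 0) (x : E d),
                ENNReal.ofReal (r ^ (-σ)) *
                  ⨅ (a : ℝ) (b : ℝ) (l : E d →L[ℝ] ℝ),
                    supENorm (Q σ r t x) (fun w => u w - (a + b * w.1 + l w.2))) ∧
    -- (iii) σ = 1, over all of ℝ^{d+1}
    (∃ C : ℝ, 0 < C ∧
      ∀ u : ℝ × E d → ℝ, Continuous u →
        zygFull (univ : Set (ℝ × E d)) u ≤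
          ENNReal.ofReal C *
            ⨆ (r : ℝ) (_ : 0 < r) (t : ℝ) (x : E d),
              ENNReal.ofReal (r⁻¹) *
                ⨅ (a : ℝ) (b : ℝ) (l : E d →L[ℝ] ℝ),
                  supENorm (Q 1 r t x) (fun w => u w - (a + b * w.1 + l w.2))) := by
  refine ⟨fun σ hσ => ⟨16, by norm_num, fun u _ => ?_⟩,
    fun σ hσ => ⟨12 + 6 * slopeConst σ, by linarith [slopeConst_pos hσ.1], fun u hu => ?_⟩,
    12, by norm_num, fun u _ => ?_⟩
  · refine le_ofReal_mul_of_forall_lt (by norm_num) fun K hK hS => ?_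
    have happ : ∀ r : ℝ, 0 < r → ∀ t : ℝ, t < 0 → ∀ x : E d, ∃ a b : ℝ,
        ∀ w ∈ Q σ r t x, |u w - (a + b * w.1)| ≤ K * r ^ σ := fun r hr t ht x => by
      have h₁ := lt_of_le_of_lt
        (le_iSup₂_of_le r hr (le_iSup₂_of_le t ht (le_iSup_of_le x le_rfl))) hS
      have h₂ := lt_ofReal_mul_of_ofReal_mul_lt (c' := r ^ σ) (Real.rpow_pos_of_pos hr _)
        (by rw [← Real.rpow_add hr, neg_add_cancel, Real.rpow_zero]) h₁
      simp only [iInf_lt_iff] at h₂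
      obtain ⟨a, b, h⟩ := h₂
      exact ⟨a, b, norm_le_of_supENorm_lt (by positivity) h⟩
    have haff : AffineApprox σ K u := fun r hr t ht x => by
      obtain ⟨a, b, h⟩ := happ r hr t ht x
      exact ⟨a, b, 0, by simpa using h⟩
    refine (add_le_add (zygT_le_of_affineApprox hσ.1 haff)
      (holderX_le_of_time_affine_approx hσ hK.le happ)).trans (le_of_eq ?_)
    rw [← ENNReal.ofReal_add (by positivity) (by positivity)]
    congr 1
    ring
  · have hC := slopeConst_pos hσ.1
    refine le_ofReal_mul_of_forall_lt (by positivity) fun K hK hS => ?_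
    have haff : AffineApprox σ K u := fun r hr t ht x => by
      have h₁ := lt_of_le_of_lt
        (le_iSup₂_of_le r hr (le_iSup₂_of_le t ht (le_iSup_of_le x le_rfl))) hS
      have h₂ := lt_ofReal_mul_of_ofReal_mul_lt (c' := r ^ σ) (Real.rpow_pos_of_pos hr _)
        (by rw [← Real.rpow_add hr, neg_add_cancel, Real.rpow_zero]) h₁
      simp only [iInf_lt_iff] at h₂
      obtain ⟨a, b, l, h⟩ := h₂
      exact ⟨a, b, l, norm_le_of_supENorm_lt (by positivity) h⟩
    refine (add_le_add (add_le_add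
      (zygT_le_of_affineApprox (by linarith [hσ.1]) haff)
      (holderX_Du_le_of_affineApprox hσ hK.le haff hu))
      (holderT_Du_le_of_affineApprox hσ hK.le haff hu)).trans (le_of_eq ?_)
    rw [← ENNReal.ofReal_add (by positivity) (by positivity),
      ← ENNReal.ofReal_add (by positivity) (by positivity)]
    congr 1
    ring
  · refine le_ofReal_mul_of_forall_lt (by norm_num) fun K hK hS => ?_
    refine zygFull_le_of_affine_approx fun r hr t x => ?_
    have h₁ := lt_of_le_of_lt (le_iSup₂_of_le r hr (le_iSup₂_of_le t x le_rfl)) hS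
    have h₂ := lt_ofReal_mul_of_ofReal_mul_lt (c' := r) (inv_pos.2 hr)
      (inv_mul_cancel₀ hr.ne') h₁
    simp only [iInf_lt_iff] at h₂
    obtain ⟨a, b, l, h⟩ := h₂
    exact ⟨a, b, l, norm_le_of_supENorm_lt (by positivity) h⟩
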